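/- Translated Riesz integral bound in ℝ³ (Hardy–Littlewood step in the proof of Lemma B.1): For every a > 0, ∫_{ℝ³} (|x|² (1 + a|x|²))^{−1} dx = 2π²/√a, and for every p ∈ ℝ³, ∫_{ℝ³} (|p+x|² (1 + a|x|²))^{−1} dx ≤ 2π²/√a. -/

import Mathlib

noncomputable section

open MeasureTheory

abbrev E3 : Type := EuclideanSpace ℝ (Fin 3)

section LayerCake

variable {α : Type*} [MeasurableSpace α] {μ : Measure α} {f g : α → ℝ}

/-- The layer cake formula for a product of two nonnegative functions. -/
theorem lintegral_mul_eq_lintegral_lintegral_meas_inter (hf : Measurable f) (hg : Measurable g)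
    (hf0 : 0 ≤ f) (hg0 : 0 ≤ g) :
    ∫⁻ x, ENNReal.ofReal (f x * g x) ∂μ =
      ∫⁻ t in Set.Ioi (0 : ℝ), ∫⁻ s in Set.Ioi (0 : ℝ), μ ({x | t < f x} ∩ {x | s < g x}) := by
  have hmul : ∫⁻ x, ENNReal.ofReal (f x * g x) ∂μ =
      ∫⁻ x, ENNReal.ofReal (f x) ∂μ.withDensity fun x => ENNReal.ofReal (g x) := by
    rw [lintegral_withDensity_eq_lintegral_mul _ hg.ennreal_ofReal hf.ennreal_ofReal]
    refine lintegral_congr fun x => ?_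
    rw [Pi.mul_apply, mul_comm, ENNReal.ofReal_mul (hg0 x)]
  rw [hmul, lintegral_eq_lintegral_meas_lt _ (.of_forall hf0) hf.aemeasurable]
  refine lintegral_congr fun t => ?_
  rw [withDensity_apply _ (measurableSet_lt measurable_const hf),
    lintegral_eq_lintegral_meas_lt _ (.of_forall hg0) hg.aemeasurable]
  refine lintegral_congr fun s => ?_
  rw [Measure.restrict_apply (measurableSet_lt measurable_const hg), Set.inter_comm]

/-- Superlevel sets of functions that monovary on a conull set are nested up to null sets. -/
theorem MonovaryOn.meas_inter_superlevel_eq_min {S : Set α} (hfg : MonovaryOn f g S)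
    (hS : ∀ᵐ x ∂μ, x ∈ S) (t s : ℝ) :
    μ ({x | t < f x} ∩ {x | s < g x}) = min (μ {x | t < f x}) (μ {x | s < g x}) := by
  refine le_antisymm
    (le_min (measure_mono Set.inter_subset_left) (measure_mono Set.inter_subset_right)) ?_
  by_cases h : ∀ x ∈ S, t < f x → s < g x
  · refine (min_le_left _ _).trans (measure_mono_ae ?_)
    filter_upwards [hS] with x hx hxt
    exact ⟨hxt, h x hx hxt⟩
  · push Not at h
    obtain ⟨x, hx, hxt, hxs⟩ := h
    refine (min_le_right _ _).trans (measure_mono_ae ?_)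
    filter_upwards [hS] with y hy hys
    exact ⟨hxt.trans_le (hfg hx hy (hxs.trans_lt hys)), hys⟩

/-- A rearrangement inequality: translating one of two monovarying nonnegative functions
does not increase the integral of their product. -/
theorem MonovaryOn.lintegral_translate_mul_le [AddGroup α] [MeasurableAdd α]
    [μ.IsAddLeftInvariant] {S : Set α} (hfg : MonovaryOn f g S) (hS : ∀ᵐ x ∂μ, x ∈ S)
    (hf : Measurable f) (hg : Measurable g) (hf0 : 0 ≤ f) (hg0 : 0 ≤ g) (p : α) :
    ∫⁻ x, ENNReal.ofReal (f (p + x) * g x) ∂μ ≤ ∫⁻ x, ENNReal.ofReal (f x * g x) ∂μ := by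
  rw [lintegral_mul_eq_lintegral_lintegral_meas_inter (f := fun x => f (p + x))
      (hf.comp (measurable_const_add p)) hg (fun x => hf0 (p + x)) hg0,
    lintegral_mul_eq_lintegral_lintegral_meas_inter hf hg hf0 hg0]
  refine lintegral_mono fun t => lintegral_mono fun s => ?_
  rw [hfg.meas_inter_superlevel_eq_min hS]
  refine le_min ((measure_mono Set.inter_subset_left).trans_eq ?_)
    (measure_mono Set.inter_subset_right)
  exact measure_preimage_add μ p {x | t < f x}

end LayerCake

theorem lintegral_riesz_R3 {a : ℝ} (ha : 0 < a) :
    ∫⁻ x : E3, ENNReal.ofReal ((‖x‖ ^ 2 * (1 + a * ‖x‖ ^ 2))⁻¹) =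
      ENNReal.ofReal (2 * Real.pi ^ 2 / Real.sqrt a) := by
  have hsa : 0 < Real.sqrt a := Real.sqrt_pos.2 ha
  have hradial : Set.EqOn (fun y : ℝ => y ^ (Module.finrank ℝ E3 - 1) •
      (y ^ 2 * (1 + a * y ^ 2))⁻¹) (fun y => (1 + (Real.sqrt a * y) ^ 2)⁻¹) (Set.Ioi 0) := by
    intro y hy
    have hy : 0 < y := hy
    simp only [finrank_euclideanSpace_fin, smul_eq_mul, mul_pow, Real.sq_sqrt ha.le]
    field_simp
  have hint : Integrable fun x : E3 => (‖x‖ ^ 2 * (1 + a * ‖x‖ ^ 2))⁻¹ := by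
    rw [integrable_fun_norm_addHaar volume (f := fun y => (y ^ 2 * (1 + a * y ^ 2))⁻¹),
      integrableOn_congr_fun hradial measurableSet_Ioi]
    exact (integrable_inv_one_add_sq.comp_mul_left' hsa.ne').integrableOn
  rw [← ofReal_integral_eq_lintegral_ofReal hint (.of_forall fun x => by positivity),
    integral_fun_norm_addHaar volume (fun y => (y ^ 2 * (1 + a * y ^ 2))⁻¹),
    setIntegral_congr_fun measurableSet_Ioi hradial,
    integral_comp_mul_left_Ioi (fun y => (1 + y ^ 2)⁻¹) 0 hsa]
  congr 1
  simp only [Measure.real, EuclideanSpace.volume_ball_fin_three, ENNReal.toReal_mul,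
    ENNReal.toReal_pow, ENNReal.toReal_ofReal (show 0 ≤ Real.pi * 4 / 3 by positivity),
    ENNReal.ofReal_one, ENNReal.toReal_one, finrank_euclideanSpace_fin, mul_zero,
    integral_Ioi_inv_one_add_sq, Real.arctan_zero, nsmul_eq_mul, smul_eq_mul]
  field_simp
  push_cast
  ring

/-- **Translated Riesz integral bound in ℝ³** (Hardy–Littlewood step in the proof of
Lemma B.1): `∫ (|x|²(1+a|x|²))⁻¹ dx = 2π²/√a` and, for any shift `p`,
`∫ (|p+x|²(1+a|x|²))⁻¹ dx ≤ 2π²/√a`. -/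
theorem translated_riesz_integral_R3 (a : ℝ) (ha : 0 < a) :
    ((∫⁻ x : E3, ENNReal.ofReal ((‖x‖ ^ 2 * (1 + a * ‖x‖ ^ 2))⁻¹))
        = ENNReal.ofReal (2 * Real.pi ^ 2 / Real.sqrt a)) ∧
    ∀ p : E3,
      (∫⁻ x : E3, ENNReal.ofReal ((‖p + x‖ ^ 2 * (1 + a * ‖x‖ ^ 2))⁻¹))
        ≤ ENNReal.ofReal (2 * Real.pi ^ 2 / Real.sqrt a) := by
  refine ⟨lintegral_riesz_R3 ha, fun p => ?_⟩
  have hmono : MonovaryOn (fun x : E3 => (‖x‖ ^ 2)⁻¹) (fun x => (1 + a * ‖x‖ ^ 2)⁻¹) {0}ᶜ := by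
    intro x _ y hy hxy
    have hy : 0 < ‖y‖ := norm_pos_iff.2 hy
    have h := (inv_lt_inv₀ (by positivity) (by positivity)).1 hxy
    exact inv_anti₀ (by positivity)
      (le_of_mul_le_mul_left (le_of_add_le_add_left h.le) ha)
  have h := hmono.lintegral_translate_mul_le (μ := volume) (Measure.ae_ne volume 0)
    (by fun_prop) (by fun_prop) (fun x => by positivity) (fun x => by positivity) p
  simp only [← mul_inv] at h
  exact h.trans_eq (lintegral_riesz_R3 ha)
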